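/- arXiv:2410.22329 — 5 statements merged into one kernel-verified Lean document; each statement's English description precedes it below -/
import Mathlib

section
/- For integers 1 ≤ k ≤ n, the following polynomial identity holds in ℤ[x]: Σ_{I ⊆ {1,…,k}, 1 ∈ I} binom(n, ΔI) · x^{|I|−1} = Σ_{σ ∈ S_k, Des(σ) ∈ nc(k−1), 1 ∉ Des(σ)} binom(n−σ(k), k−σ(k)) · x^{des(σ)} · (1+x)^{k−1−2·des(σ)}. (Both sides equal the Chow polynomial of the uniform matroid U_{k,n}.) -/
open Finset Polynomial

/-- Differences list: `diffList N prev [m₁,…,m_s] = [m₁ - prev, m₂ - m₁, …, N - m_s]`. -/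
def diffList (N : ℕ) : ℕ → List ℕ → List ℕ
  | prev, [] => [N - prev]
  | prev, m :: ms => (m - prev) :: diffList N m ms

/-- The minima of the maximal blocks of consecutive integers of `I`, listed increasingly. -/
def blockMinima (I : Finset ℕ) : List ℕ :=
  (I.filter fun i => i - 1 ∉ I).sort (· ≤ ·)

/-- The multinomial coefficient `binom(n, ΔI)`:
for `I` with block minima `m₁ < … < m_s` this is
`n! / ((m₁-1)! (m₂-m₁)! ⋯ (m_s-m_{s-1})! (n-m_s+1)!)`, and `1` for `I = ∅`. -/
def binomDelta (n : ℕ) (I : Finset ℕ) : ℕ :=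
  n.factorial / ((diffList (n + 1) 1 (blockMinima I)).map Nat.factorial).prod

/-- One-line notation: `oneline n w i = w(i)` for `i ∈ {1,…,n}`, with values in `{1,…,n}`. -/
def oneline (n : ℕ) (w : Equiv.Perm (Fin n)) (i : ℕ) : ℕ :=
  if h : i - 1 < n then (w ⟨i - 1, h⟩ : ℕ) + 1 else 0

/-- The descent set `Des(w) ⊆ {1,…,n-1}` of a permutation `w` of `{1,…,n}`:
positions `i` with `w(i) > w(i+1)`. -/
def descSet (n : ℕ) (w : Equiv.Perm (Fin n)) : Finset ℕ :=
  (Finset.Ico 1 n).filter fun i => oneline n w (i + 1) < oneline n w i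

/-- `E(n, D)`: the number of permutations of `{1,…,n}` with descent set exactly `D`. -/
def eulerianCount (n : ℕ) (D : Finset ℕ) : ℕ :=
  (Finset.univ.filter fun w : Equiv.Perm (Fin n) => descSet n w = D).card

theorem card_compl_of_card_eq {k d : ℕ} (A : {A : Finset (Fin (k + d)) // A.card = k}) :
    (A.1ᶜ).card = d := by
  rw [Finset.card_compl, A.2, Fintype.card_fin]; omega

/-- The permutation of `Fin (k + d)` whose first `k` values form the set `A`, arranged in the
relative order prescribed by `σ`, and whose last `d` values are increasing. -/
def shuffle {k d : ℕ} (A : {A : Finset (Fin (k + d)) // A.card = k}) (σ : Equiv.Perm (Fin k)) :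
    Equiv.Perm (Fin (k + d)) :=
  finSumFinEquiv.symm.trans ((Equiv.sumCongr σ (Equiv.refl (Fin d))).trans
    (finSumEquivOfFinset A.2 (card_compl_of_card_eq A)))

theorem shuffle_castAdd {k d : ℕ} (A : {A : Finset (Fin (k + d)) // A.card = k})
    (σ : Equiv.Perm (Fin k)) (i : Fin k) :
    shuffle A σ (Fin.castAdd d i) = A.1.orderEmbOfFin A.2 (σ i) := by
  simp [shuffle]

theorem shuffle_natAdd {k d : ℕ} (A : {A : Finset (Fin (k + d)) // A.card = k})
    (σ : Equiv.Perm (Fin k)) (i : Fin d) :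
    shuffle A σ (Fin.natAdd k i) = A.1ᶜ.orderEmbOfFin (card_compl_of_card_eq A) i := by
  simp [shuffle]

theorem oneline_succ {n : ℕ} (w : Equiv.Perm (Fin n)) (i : Fin n) :
    oneline n w (i + 1) = w i + 1 := by
  simp [oneline]

theorem succ_mem_descSet {n : ℕ} (w : Equiv.Perm (Fin n)) (i : ℕ) :
    i + 1 ∈ descSet n w ↔ ∃ h : i + 1 < n, w ⟨i + 1, h⟩ < w ⟨i, by omega⟩ := by
  simp only [descSet, oneline, mem_filter, mem_Ico, add_tsub_cancel_right, Fin.lt_def]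
  constructor
  · rintro ⟨⟨-, h⟩, h'⟩
    refine ⟨h, ?_⟩
    rw [dif_pos h, dif_pos (by omega)] at h'
    omega
  · rintro ⟨h, h'⟩
    refine ⟨⟨by omega, h⟩, ?_⟩
    rw [dif_pos h, dif_pos (by omega)]
    omega

theorem zero_notMem_descSet {n : ℕ} (w : Equiv.Perm (Fin n)) : 0 ∉ descSet n w := by
  simp [descSet]

theorem descSet_filter_shuffle {k d : ℕ} (A : {A : Finset (Fin (k + d)) // A.card = k})
    (σ : Equiv.Perm (Fin k)) : (descSet (k + d) (shuffle A σ)).filter (· < k) = descSet k σ := by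
  ext i
  obtain _ | i := i
  · simp [zero_notMem_descSet]
  rw [mem_filter, succ_mem_descSet, succ_mem_descSet]
  have key : ∀ h : i + 1 < k,
      (shuffle A σ ⟨i + 1, by omega⟩ < shuffle A σ ⟨i, by omega⟩ ↔
        σ ⟨i + 1, h⟩ < σ ⟨i, by omega⟩) := by
    intro h
    have h1 := shuffle_castAdd A σ ⟨i + 1, h⟩
    have h2 := shuffle_castAdd A σ ⟨i, by omega⟩
    simp only [Fin.castAdd_mk] at h1 h2
    rw [h1, h2, OrderEmbedding.lt_iff_lt]
  constructor
  · rintro ⟨⟨_, h⟩, h'⟩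
    exact ⟨h', (key h').1 h⟩
  · rintro ⟨h', h⟩
    exact ⟨⟨by omega, (key h').2 h⟩, h'⟩

theorem strictMono_natAdd_iff {k d : ℕ} (w : Equiv.Perm (Fin (k + d))) :
    StrictMono (fun i : Fin d => w (Fin.natAdd k i)) ↔ ∀ i ∈ descSet (k + d) w, i ≤ k := by
  constructor
  · intro hw i hi
    obtain _ | i := i
    · omega
    obtain ⟨h, h'⟩ := (succ_mem_descSet w i).1 hi
    by_contra! hk
    refine absurd h' (not_lt.2 (le_of_lt ?_))
    have := @hw ⟨i - k, by omega⟩ ⟨i + 1 - k, by omega⟩ (by simp [Fin.lt_def]; omega)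
    simp only [Fin.natAdd_mk] at this
    convert this using 3 <;> omega
  · intro H
    obtain _ | d := d
    · exact fun i => i.elim0
    refine Fin.strictMono_iff_lt_succ.2 fun i => ?_
    by_contra! h
    have h0 := lt_of_le_of_ne h (fun e => by
      have := congrArg Fin.val (w.injective e)
      simp at this)
    have := H (k + i + 1) ((succ_mem_descSet w _).2 ⟨by omega, h0⟩)
    omega

theorem shuffle_injective {k d : ℕ} {A B : {A : Finset (Fin (k + d)) // A.card = k}}
    {σ τ : Equiv.Perm (Fin k)} (h : shuffle A σ = shuffle B τ) : A = B ∧ σ = τ := by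
  have hsub : ∀ {A B : {A : Finset (Fin (k + d)) // A.card = k}} {σ τ : Equiv.Perm (Fin k)},
      shuffle A σ = shuffle B τ → A.1 ⊆ B.1 := by
    intro A B σ τ h x hx
    obtain ⟨i, rfl⟩ : x ∈ Set.range (A.1.orderEmbOfFin A.2) := by simpa using hx
    obtain ⟨j, rfl⟩ := σ.surjective i
    rw [← shuffle_castAdd, h, shuffle_castAdd]
    exact orderEmbOfFin_mem _ _ _
  obtain rfl : A = B := Subtype.ext (Subset.antisymm (hsub h) (hsub h.symm))
  refine ⟨rfl, Equiv.ext fun i => ?_⟩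
  have := shuffle_castAdd A σ i
  rw [h, shuffle_castAdd] at this
  exact ((A.1.orderEmbOfFin A.2).injective this).symm

theorem exists_shuffle_eq {k d : ℕ} (w : Equiv.Perm (Fin (k + d)))
    (hw : ∀ i ∈ descSet (k + d) w, i ≤ k) : ∃ A σ, shuffle A σ = w := by
  have hinj : Function.Injective fun i : Fin k => w (Fin.castAdd d i) :=
    w.injective.comp (Fin.castAdd_injective k d)
  let A : {A : Finset (Fin (k + d)) // A.card = k} :=
    ⟨univ.image fun i : Fin k => w (Fin.castAdd d i), by
      rw [card_image_of_injective _ hinj, card_univ, Fintype.card_fin]⟩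
  have hA : ∀ i : Fin k, ∃ j, A.1.orderEmbOfFin A.2 j = w (Fin.castAdd d i) := fun i => by
    have : w (Fin.castAdd d i) ∈ Set.range (A.1.orderEmbOfFin A.2) := by simp [A]
    exact this
  choose f hf using hA
  have hfinj : Function.Injective f := fun i j hij => hinj (by
    simp only [← hf, hij])
  refine ⟨A, Equiv.ofBijective f (Finite.injective_iff_bijective.1 hfinj), Equiv.ext ?_⟩
  refine Fin.addCases (fun i => ?_) (fun i => ?_)
  · rw [shuffle_castAdd, Equiv.ofBijective_apply, hf]
  · rw [shuffle_natAdd]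
    refine (congrFun (orderEmbOfFin_unique (card_compl_of_card_eq A) (fun i => ?_)
      ((strictMono_natAdd_iff w).2 hw)) i).symm
    simp only [A, mem_compl, mem_image, mem_univ, true_and, not_exists]
    intro j h
    have := congrArg Fin.val (w.injective h)
    simp at this
    omega

theorem shuffle_descSet_le {k d : ℕ} (A : {A : Finset (Fin (k + d)) // A.card = k})
    (σ : Equiv.Perm (Fin k)) : ∀ i ∈ descSet (k + d) (shuffle A σ), i ≤ k := by
  rw [← strictMono_natAdd_iff]
  simp only [shuffle_natAdd]
  exact OrderEmbedding.strictMono _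

theorem sum_shuffle {M : Type*} [AddCommMonoid M] {k d : ℕ} (f : Equiv.Perm (Fin (k + d)) → M) :
    ∑ w with ∀ i ∈ descSet (k + d) w, i ≤ k, f w =
      ∑ σ : Equiv.Perm (Fin k), ∑ A : {A : Finset (Fin (k + d)) // A.card = k},
        f (shuffle A σ) := by
  rw [← Fintype.sum_prod_type']
  symm
  refine sum_bij (fun p _ => shuffle p.2 p.1) (fun p _ => ?_) (fun p _ q _ h => ?_)
    (fun w hw => ?_) (fun _ _ => rfl)
  · simpa using shuffle_descSet_le p.2 p.1
  · exact Prod.ext (shuffle_injective h).2 (shuffle_injective h).1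
  · obtain ⟨A, σ, h⟩ := exists_shuffle_eq w (by simpa using hw)
    exact ⟨(σ, A), mem_univ _, h⟩

theorem card_forall_descSet_or_eq {k d : ℕ} (p : ℕ → Prop) [DecidablePred p]
    (hp : ∀ i, p i → i < k) :
    (univ.filter fun w : Equiv.Perm (Fin (k + d)) =>
        ∀ i ∈ descSet (k + d) w, p i ∨ i = k).card =
      (k + d).choose k *
        (univ.filter fun σ : Equiv.Perm (Fin k) => ∀ i ∈ descSet k σ, p i).card := by
  have h := sum_shuffle (k := k) (d := d)
    (fun w => if ∀ i ∈ descSet (k + d) w, p i ∨ i = k then 1 else 0)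
  rw [← sum_filter, filter_filter, ← card_eq_sum_ones] at h
  have h1 : ∀ w : Equiv.Perm (Fin (k + d)), ((∀ i ∈ descSet (k + d) w, i ≤ k) ∧
      ∀ i ∈ descSet (k + d) w, p i ∨ i = k) ↔ ∀ i ∈ descSet (k + d) w, p i ∨ i = k := fun w =>
    and_iff_right_of_imp fun h i hi => (h i hi).elim (fun h => (hp i h).le) le_of_eq
  have h2 : ∀ (σ : Equiv.Perm (Fin k)) (A : {A : Finset (Fin (k + d)) // A.card = k}),
      (∀ i ∈ descSet (k + d) (shuffle A σ), p i ∨ i = k) ↔ ∀ i ∈ descSet k σ, p i := by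
    intro σ A
    rw [← descSet_filter_shuffle A σ]
    simp only [mem_filter]
    exact ⟨fun h i hi => (h i hi.1).resolve_right hi.2.ne, fun h i hi =>
      (shuffle_descSet_le A σ i hi).lt_or_eq.imp_left fun hlt => h i ⟨hi, hlt⟩⟩
  simp only [h1, h2] at h
  rw [h, card_filter, mul_sum]
  refine sum_congr rfl fun σ _ => ?_
  rw [sum_const, card_univ, Fintype.card_finset_len, Fintype.card_fin, smul_eq_mul]

theorem eq_one_of_descSet_eq_empty {n : ℕ} {w : Equiv.Perm (Fin n)} (h : descSet n w = ∅) :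
    w = 1 := by
  have hmono : StrictMono w := by
    obtain _ | n := n
    · exact fun i => i.elim0
    refine Fin.strictMono_iff_lt_succ.2 fun i => ?_
    by_contra! hlt
    have h0 := lt_of_le_of_ne hlt (w.injective.ne (Fin.castSucc_lt_succ (i := i)).ne')
    have := (succ_mem_descSet w i).2 ⟨by omega, h0⟩
    simp [h] at this
  exact Equiv.ext (congrFun ((hmono.range_inj strictMono_id).1 (by simp)))

theorem descSet_one (n : ℕ) : descSet n 1 = ∅ := by
  refine eq_empty_of_forall_notMem fun i hi => ?_
  obtain _ | i := i
  · exact zero_notMem_descSet _ hi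
  · obtain ⟨h, h'⟩ := (succ_mem_descSet _ _).1 hi
    simp [Fin.lt_def] at h'

theorem diffList_append_singleton (N p m : ℕ) (L : List ℕ) :
    diffList N p (L ++ [m]) = diffList m p L ++ [N - m] := by
  induction L generalizing p with
  | nil => rfl
  | cons a L ih => simp [diffList, ih]

theorem card_forall_descSet_succ_mem_mul (L : List ℕ) (n : ℕ) (hL : L.Pairwise (· < ·))
    (hn : ∀ m ∈ L, 1 ≤ m ∧ m ≤ n) :
    (univ.filter fun w : Equiv.Perm (Fin n) => ∀ i ∈ descSet n w, i + 1 ∈ L).card *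
      ((diffList (n + 1) 1 L).map Nat.factorial).prod = n.factorial := by
  induction L using List.reverseRecOn generalizing n with
  | nil =>
    have : (univ.filter fun w : Equiv.Perm (Fin n) => ∀ i ∈ descSet n w, i + 1 ∈ []) = {1} := by
      ext w
      simp only [List.not_mem_nil, mem_filter, mem_univ, true_and, mem_singleton]
      refine ⟨fun h => eq_one_of_descSet_eq_empty (eq_empty_of_forall_notMem h), ?_⟩
      rintro rfl
      simp [descSet_one]
    rw [this]
    simp [diffList]
  | append_singleton L m ih =>
    rw [List.pairwise_append] at hL
    obtain ⟨hm1, hmn⟩ := hn m (by simp)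
    obtain ⟨k, rfl⟩ : ∃ k, m = k + 1 := ⟨m - 1, by omega⟩
    obtain ⟨d, rfl⟩ : ∃ d, n = k + d := ⟨n - k, by omega⟩
    have hlt : ∀ a ∈ L, a < k + 1 := fun a ha => hL.2.2 a ha _ (by simp)
    have ih := ih k hL.1 fun a ha => ⟨(hn a (by simp [ha])).1, Nat.lt_succ_iff.1 (hlt a ha)⟩
    have hc := card_forall_descSet_or_eq (k := k) (d := d) (fun i => i + 1 ∈ L)
      (fun i hi => by simpa using hlt _ hi)
    simp only [List.mem_append, List.mem_singleton, Nat.add_right_cancel_iff]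
    rw [hc, diffList_append_singleton, List.map_append, List.prod_append]
    have hd : k + d + 1 - (k + 1) = d := by omega
    have := Nat.add_choose_mul_factorial_mul_factorial k d
    simp only [List.map_cons, List.map_nil, List.prod_singleton, hd]
    rw [← this, ← Nat.choose_symm_add, ← ih]
    ring

theorem succ_mem_blockMinima {I : Finset ℕ} {i : ℕ} :
    i + 1 ∈ blockMinima I ↔ i ∉ I ∧ i + 1 ∈ I := by
  simp [blockMinima, and_comm]

theorem binomDelta_eq_card {n : ℕ} {I : Finset ℕ} (hI : I ⊆ Icc 1 n) :
    binomDelta n I = (univ.filter fun w : Equiv.Perm (Fin n) =>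
      ∀ i ∈ descSet n w, i ∉ I ∧ i + 1 ∈ I).card := by
  have h := card_forall_descSet_succ_mem_mul (blockMinima I) n (sortedLT_sort _).pairwise
    (fun m hm => by simpa using hI (mem_filter.1 ((mem_sort _).1 hm)).1)
  simp only [succ_mem_blockMinima] at h
  rw [binomDelta, ← h]
  refine Nat.mul_div_cancel _ (Nat.pos_of_ne_zero fun h0 => ?_)
  rw [h0, mul_zero] at h
  exact n.factorial_ne_zero h.symm

theorem card_initial_segment {k d : ℕ} (j : Fin k) :
    (univ.filter fun A : {A : Finset (Fin (k + d)) // A.card = k} =>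
      ∀ x ∉ A.1, A.1.orderEmbOfFin A.2 j < x).card = (k + d - (j + 1)).choose (k - (j + 1)) := by
  have hcard : (Iic (Fin.castAdd d j)).card = j + 1 := by simp
  have key : ∀ A : {A : Finset (Fin (k + d)) // A.card = k},
      (∀ x ∉ A.1, A.1.orderEmbOfFin A.2 j < x) ↔ Iic (Fin.castAdd d j) ⊆ A.1 := by
    intro A
    set e := A.1.orderEmbOfFin A.2 with he
    have hge : Fin.castAdd d j ≤ e j := by
      have hsub : (Iio j).map e.toEmbedding ⊆ Iio (e j) := by
        intro y hy
        obtain ⟨i, hi, rfl⟩ := mem_map.1 hy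
        simpa using hi
      simpa [Fin.le_def] using card_le_card hsub
    constructor
    · intro h x hx
      by_contra hxA
      exact absurd (h x hxA) (not_lt.2 ((mem_Iic.1 hx).trans hge))
    · intro h x hx
      have hle : e j ≤ Fin.castAdd d j := by
        by_contra! hlt
        have hsub : Iic (Fin.castAdd d j) ⊆ (Iio j).map e.toEmbedding := by
          intro y hy
          obtain ⟨i, rfl⟩ : y ∈ Set.range e := by simpa [he] using h hy
          have : e i < e j := (mem_Iic.1 hy).trans_lt hlt
          simpa using this
        have := card_le_card hsub
        rw [hcard, card_map, Fin.card_Iio] at this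
        omega
      refine hle.trans_lt (not_le.1 fun hxj => hx (h (mem_Iic.2 hxj)))
  simp only [key]
  have hcount := card_filter_powersetCard_subset (Iic (Fin.castAdd d j)) univ k (subset_univ _)
    (by rw [hcard]; exact j.2)
  rw [card_univ, Fintype.card_fin, hcard] at hcount
  rw [← hcount]
  refine card_bij (fun A _ => A.1) (fun A hA => ?_) (fun A _ B _ h => Subtype.ext h)
    fun A hA => ?_
  · simpa [A.2] using hA
  · simp only [mem_filter, mem_powersetCard, subset_univ, true_and] at hA
    exact ⟨⟨A, hA.1⟩, by simpa using hA.2, rfl⟩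

theorem forall_descSet_shuffle_lt_iff {k d : ℕ}
    (A : {A : Finset (Fin (k + 1 + d)) // A.card = k + 1})
    (σ : Equiv.Perm (Fin (k + 1))) :
    (∀ i ∈ descSet (k + 1 + d) (shuffle A σ), i < k + 1) ↔
      ∀ x ∉ A.1, A.1.orderEmbOfFin A.2 (σ (Fin.last k)) < x := by
  have hlast := shuffle_castAdd A σ (Fin.last k)
  constructor
  · intro h x hx
    obtain ⟨t, rfl⟩ : x ∈ Set.range (A.1ᶜ.orderEmbOfFin (card_compl_of_card_eq A)) := by
      simpa using hx
    have hd : 0 < d := t.pos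
    have h0 := shuffle_natAdd A σ ⟨0, hd⟩
    refine lt_of_lt_of_le ?_ ((OrderEmbedding.le_iff_le _).2 (Fin.mk_le_of_le_val t.val.zero_le :
      (⟨0, hd⟩ : Fin d) ≤ t))
    rw [← h0, ← hlast]
    by_contra! hle
    have hlt := lt_of_le_of_ne hle ((shuffle A σ).injective.ne (by simp [Fin.ext_iff]))
    exact lt_irrefl _ (h (k + 1) ((succ_mem_descSet _ _).2 ⟨by omega, hlt⟩))
  · intro h i hi
    refine lt_of_le_of_ne (shuffle_descSet_le A σ i hi) ?_
    rintro rfl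
    obtain ⟨hd, hlt⟩ := (succ_mem_descSet _ _).1 hi
    have h0 := shuffle_natAdd A σ ⟨0, by omega⟩
    have h1 := h _ (mem_compl.1 (orderEmbOfFin_mem _ (card_compl_of_card_eq A) ⟨0, by omega⟩))
    rw [← h0, ← hlast] at h1
    exact lt_asymm hlt h1

theorem sum_descSet_lt {R : Type*} [CommSemiring R] {n k : ℕ} (hk : 1 ≤ k) (hkn : k ≤ n)
    (g : Finset ℕ → R) :
    ∑ w : Equiv.Perm (Fin n) with ∀ i ∈ descSet n w, i < k, g (descSet n w) =
      ∑ σ : Equiv.Perm (Fin k),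
        ((n - oneline k σ k).choose (k - oneline k σ k) : R) * g (descSet k σ) := by
  obtain ⟨k, rfl⟩ : ∃ m, k = m + 1 := ⟨k - 1, by omega⟩
  obtain ⟨d, rfl⟩ : ∃ d, n = k + 1 + d := ⟨n - (k + 1), by omega⟩
  have h := sum_shuffle (k := k + 1) (d := d)
    (fun w => if ∀ i ∈ descSet (k + 1 + d) w, i < k + 1 then g (descSet (k + 1 + d) w) else 0)
  rw [← sum_filter, filter_filter] at h
  have h1 : ∀ w : Equiv.Perm (Fin (k + 1 + d)), ((∀ i ∈ descSet (k + 1 + d) w, i ≤ k + 1) ∧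
      ∀ i ∈ descSet (k + 1 + d) w, i < k + 1) ↔ ∀ i ∈ descSet (k + 1 + d) w, i < k + 1 := fun w =>
    and_iff_right_of_imp fun h i hi => (h i hi).le
  simp only [h1] at h
  rw [h]
  refine sum_congr rfl fun σ _ => ?_
  have h2 : oneline (k + 1) σ (k + 1) = σ (Fin.last k) + 1 := oneline_succ σ (Fin.last k)
  rw [h2, ← card_initial_segment, ← nsmul_eq_mul, ← sum_const, ← sum_filter]
  refine sum_congr (filter_congr fun A _ => forall_descSet_shuffle_lt_iff A σ) fun A hA => ?_
  rw [← descSet_filter_shuffle A σ, filter_true_of_mem]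
  exact (forall_descSet_shuffle_lt_iff A σ).2 (mem_filter.1 hA).2

theorem sum_pow_card_sub_one {R : Type*} [CommSemiring R] (x : R) {k : ℕ} (hk : 1 ≤ k)
    (D : Finset ℕ) (h0 : 0 ∉ D) :
    ∑ I ∈ (Icc 1 k).powerset with 1 ∈ I ∧ ∀ i ∈ D, i ∉ I ∧ i + 1 ∈ I, x ^ (I.card - 1) =
      if D ⊆ Icc 1 (k - 1) ∧ (∀ i ∈ D, i + 1 ∉ D) ∧ 1 ∉ D then
        x ^ D.card * (1 + x) ^ (k - 1 - 2 * D.card) else 0 := by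
  split_ifs with h
  · obtain ⟨hD, hnc, h1⟩ := h
    set D' := D.map (addRightEmbedding 1) with hD'
    have hmem : ∀ i, i ∈ D' ↔ ∃ j ∈ D, j + 1 = i := by simp [hD']
    have hdisj : Disjoint D D' := by
      rw [disjoint_right]
      intro i hi
      obtain ⟨j, hj, rfl⟩ := (hmem i).1 hi
      exact hnc j hj
    have hsub : D ∪ D' ⊆ Icc 2 k := by
      intro i hi
      rw [mem_union, hmem] at hi
      rw [mem_Icc]
      obtain hi | ⟨j, hi, rfl⟩ := hi
      · have := mem_Icc.1 (hD hi)
        have : i ≠ 1 := fun h => h1 (h ▸ hi)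
        omega
      · have := mem_Icc.1 (hD hi)
        omega
    set F := Icc 2 k \ (D ∪ D') with hF
    have hFcard : F.card = k - 1 - 2 * D.card := by
      rw [hF, card_sdiff_of_subset hsub, card_union_of_disjoint hdisj, hD', card_map,
        Nat.card_Icc]
      omega
    have h1D' : 1 ∉ D' := by
      rw [hmem]
      rintro ⟨j, hj, hj1⟩
      exact h0 ((by omega : j = 0) ▸ hj)
    have hdF : ∀ J ⊆ F, Disjoint J (insert 1 D') := by
      intro J hJ
      rw [disjoint_left]
      intro i hi
      have := mem_sdiff.1 (hJ hi)
      simp only [mem_Icc, mem_union, not_or] at this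
      simp only [mem_insert, not_or]
      exact ⟨by omega, this.2.2⟩
    have hsum := sum_pow_mul_eq_add_pow x 1 F
    simp only [one_pow, mul_one] at hsum
    rw [← hFcard, add_comm 1 x, ← hsum, mul_sum]
    refine sum_bij' (fun I _ => I \ insert 1 D') (fun J _ => J ∪ insert 1 D') ?_ ?_ ?_ ?_ ?_
    · intro I hI
      simp only [mem_filter, mem_powerset] at hI
      obtain ⟨hIk, -, hI⟩ := hI
      rw [mem_powerset]
      intro i hi
      simp only [mem_sdiff, mem_insert, not_or] at hi
      have := mem_Icc.1 (hIk hi.1)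
      simp only [hF, mem_sdiff, mem_Icc, mem_union, not_or]
      exact ⟨by omega, fun hiD => (hI i hiD).1 hi.1, hi.2.2⟩
    · intro J hJ
      rw [mem_powerset] at hJ
      simp only [mem_filter, mem_powerset]
      refine ⟨?_, by simp, fun i hi => ⟨?_, ?_⟩⟩
      · intro i hi
        simp only [mem_union, mem_insert] at hi
        rw [mem_Icc]
        obtain hi | rfl | hi := hi
        · have := mem_Icc.1 (mem_sdiff.1 (hJ hi)).1
          omega
        · omega
        · have := mem_Icc.1 (hsub (mem_union_right _ hi))
          omega
      · simp only [mem_union, mem_insert, not_or]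
        exact ⟨fun hiJ => (mem_sdiff.1 (hJ hiJ)).2 (mem_union_left _ hi),
          fun h => h1 (h ▸ hi), disjoint_left.1 hdisj hi⟩
      · simp only [mem_union, mem_insert]
        exact Or.inr (Or.inr ((hmem _).2 ⟨i, hi, rfl⟩))
    · intro I hI
      simp only [mem_filter, mem_powerset] at hI
      refine sdiff_union_of_subset (insert_subset hI.2.1 fun i hi => ?_)
      obtain ⟨j, hj, rfl⟩ := (hmem i).1 hi
      exact (hI.2.2 j hj).2
    · intro J hJ
      exact union_sdiff_cancel_right (hdF J (mem_powerset.1 hJ))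
    · intro I hI
      simp only [mem_filter, mem_powerset] at hI
      have hsub' : insert 1 D' ⊆ I := insert_subset hI.2.1 fun i hi => by
        obtain ⟨j, hj, rfl⟩ := (hmem i).1 hi
        exact (hI.2.2 j hj).2
      have hc := card_sdiff_add_card_eq_card hsub'
      rw [card_insert_of_notMem h1D', hD', card_map, ← hD'] at hc
      rw [← pow_add]
      congr 1
      omega
  · refine sum_eq_zero fun I hI => absurd ?_ h
    simp only [mem_filter, mem_powerset] at hI
    obtain ⟨hIk, h1, hI⟩ := hI
    refine ⟨fun i hi => ?_, fun i hi hi' => (hI _ hi').1 (hI i hi).2, fun h => (hI 1 h).1 h1⟩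
    have := mem_Icc.1 (hIk (hI i hi).2)
    have : i ≠ 0 := fun h => h0 (h ▸ hi)
    rw [mem_Icc]
    omega

/-- For `1 ≤ k ≤ n`, in `ℤ[x]`:
`Σ_{I ⊆ {1,…,k}, 1 ∈ I} binom(n, ΔI) x^{|I|-1}
  = Σ_{σ ∈ S_k, Des(σ) ∈ nc(k-1), 1 ∉ Des(σ)} binom(n-σ(k), k-σ(k)) x^{des σ} (1+x)^{k-1-2·des σ}`. -/
theorem chow_uniform_monomial_eq_gamma_binomial (n k : ℕ) (hk : 1 ≤ k) (hkn : k ≤ n) :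
    ∑ I ∈ (Finset.Icc 1 k).powerset.filter (fun I => 1 ∈ I),
      (binomDelta n I : Polynomial ℤ) * X ^ (I.card - 1)
    = ∑ σ ∈ (Finset.univ : Finset (Equiv.Perm (Fin k))).filter
        (fun σ => descSet k σ ⊆ Finset.Icc 1 (k - 1)
          ∧ (∀ i ∈ descSet k σ, i + 1 ∉ descSet k σ) ∧ 1 ∉ descSet k σ),
      ((n - oneline k σ k).choose (k - oneline k σ k) : Polynomial ℤ)
        * X ^ (descSet k σ).card
        * (1 + X) ^ (k - 1 - 2 * (descSet k σ).card) := by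
  set W : Finset ℕ → Polynomial ℤ := fun D =>
    if D ⊆ Icc 1 (k - 1) ∧ (∀ i ∈ D, i + 1 ∉ D) ∧ 1 ∉ D then
      X ^ D.card * (1 + X) ^ (k - 1 - 2 * D.card) else 0 with hW
  have hleft : ∀ I ∈ (Icc 1 k).powerset.filter (fun I => 1 ∈ I),
      (binomDelta n I : Polynomial ℤ) * X ^ (I.card - 1) =
        ∑ w : Equiv.Perm (Fin n),
          if ∀ i ∈ descSet n w, i ∉ I ∧ i + 1 ∈ I then X ^ (I.card - 1) else 0 := by
    intro I hI
    rw [binomDelta_eq_card ((mem_powerset.1 (mem_filter.1 hI).1).trans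
      (Icc_subset_Icc_right hkn)), ← sum_filter, sum_const, nsmul_eq_mul]
  rw [sum_congr rfl hleft, sum_comm]
  have hinner : ∀ w : Equiv.Perm (Fin n),
      (∑ I ∈ (Icc 1 k).powerset.filter (fun I => 1 ∈ I),
        if ∀ i ∈ descSet n w, i ∉ I ∧ i + 1 ∈ I then X ^ (I.card - 1) else (0 : Polynomial ℤ)) =
      W (descSet n w) := by
    intro w
    rw [← sum_filter, filter_filter]
    exact sum_pow_card_sub_one X hk _ (zero_notMem_descSet w)
  rw [sum_congr rfl fun w _ => hinner w]
  have hsupp : ∀ w : Equiv.Perm (Fin n), W (descSet n w) ≠ 0 → ∀ i ∈ descSet n w, i < k := by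
    intro w hw i hi
    have := mem_Icc.1 ((of_not_not fun h => hw (if_neg h) :
      descSet n w ⊆ Icc 1 (k - 1) ∧ _).1 hi)
    omega
  rw [← sum_filter_of_ne fun w _ => hsupp w, sum_descSet_lt hk hkn, sum_filter]
  refine sum_congr rfl fun σ _ => ?_
  simp only [hW, mul_ite, mul_zero, mul_assoc]
end

section
/- For integers 1 ≤ k ≤ n and any subset D ⊆ {1,…,k−1}, the number of permutations of S_n with descent set exactly D satisfies E(n,D) = Σ_{σ ∈ S_k, Des(σ) = D} binom(n−σ(k), k−σ(k)). -/
open Finset Polynomial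

/-- The permutation of `Fin (k + 1)` with last value `j` whose first `k` values are in the same
relative order as those of `σ`. -/
def appendLast {k : ℕ} (j : Fin (k + 1)) (σ : Equiv.Perm (Fin k)) : Equiv.Perm (Fin (k + 1)) :=
  (finSuccEquiv' (Fin.last k)).trans ((Equiv.optionCongr σ).trans (finSuccEquiv' j).symm)

theorem appendLast_last {k : ℕ} (j : Fin (k + 1)) (σ : Equiv.Perm (Fin k)) :
    appendLast j σ (Fin.last k) = j := by
  simp [appendLast]

theorem appendLast_castSucc {k : ℕ} (j : Fin (k + 1)) (σ : Equiv.Perm (Fin k)) (i : Fin k) :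
    appendLast j σ i.castSucc = j.succAbove (σ i) := by
  rw [← Fin.succAbove_last_apply]
  simp [appendLast, - Fin.succAbove_last]

theorem appendLast_bijective (k : ℕ) :
    Function.Bijective fun p : Fin (k + 1) × Equiv.Perm (Fin k) => appendLast p.1 p.2 := by
  rw [Fintype.bijective_iff_injective_and_card]
  refine ⟨?_, by simp [Fintype.card_perm, Nat.factorial_succ]⟩
  rintro ⟨j, σ⟩ ⟨j', σ'⟩ h
  have hj : j = j' := by
    simpa [appendLast_last] using congrArg (fun w => w (Fin.last k)) h
  subst hj
  refine Prod.ext rfl (Equiv.ext fun i => ?_)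
  simpa [appendLast_castSucc] using congrArg (fun w => w i.castSucc) h

theorem oneline_appendLast_last {k : ℕ} (j : Fin (k + 1)) (σ : Equiv.Perm (Fin k)) :
    oneline (k + 1) (appendLast j σ) (k + 1) = j + 1 := by
  have h : (⟨k + 1 - 1, by omega⟩ : Fin (k + 1)) = Fin.last k := rfl
  simp only [oneline, h, appendLast_last]
  simp

theorem oneline_appendLast {k : ℕ} (j : Fin (k + 1)) (σ : Equiv.Perm (Fin k)) {i : ℕ}
    (hi : 1 ≤ i) (hik : i ≤ k) :
    oneline (k + 1) (appendLast j σ) i =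
      if oneline k σ i ≤ j then oneline k σ i else oneline k σ i + 1 := by
  have hlt : i - 1 < k := by omega
  have h : (⟨i - 1, by omega⟩ : Fin (k + 1)) = (⟨i - 1, hlt⟩ : Fin k).castSucc := rfl
  simp only [oneline, hlt, show i - 1 < k + 1 by omega, dite_true, h, appendLast_castSucc,
    Fin.succAbove, Fin.lt_def, Fin.val_castSucc, Nat.succ_le_iff]
  split_ifs <;> simp

theorem oneline_le {k : ℕ} (σ : Equiv.Perm (Fin k)) (i : ℕ) : oneline k σ i ≤ k := by
  unfold oneline
  split_ifs with h
  · exact (σ ⟨i - 1, h⟩).isLt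
  · exact Nat.zero_le k

theorem descSet_appendLast_eq_iff {k : ℕ} (hk : 1 ≤ k) {D : Finset ℕ}
    (hD : D ⊆ Icc 1 (k - 1)) (j : Fin (k + 1)) (σ : Equiv.Perm (Fin k)) :
    descSet (k + 1) (appendLast j σ) = D ↔ descSet k σ = D ∧ oneline k σ k ≤ j := by
  have hlast : k ∈ descSet (k + 1) (appendLast j σ) ↔ ¬ oneline k σ k ≤ j := by
    simp only [descSet, mem_filter, mem_Ico, oneline_appendLast_last,
      oneline_appendLast j σ hk le_rfl]
    split_ifs <;> omega
  have hlt : ∀ i, i ≠ k → (i ∈ descSet (k + 1) (appendLast j σ) ↔ i ∈ descSet k σ) := by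
    intro i hi
    simp only [descSet, mem_filter, mem_Ico]
    by_cases h : 1 ≤ i ∧ i < k
    · rw [oneline_appendLast j σ h.1 h.2.le, oneline_appendLast j σ (i := i + 1) (by omega) h.2]
      split_ifs <;> omega
    · omega
  have hkD : k ∉ D := fun h => by have := mem_Icc.1 (hD h); omega
  have hkσ : k ∉ descSet k σ := by simp [descSet]
  constructor
  · rintro rfl
    refine ⟨?_, by tauto⟩
    ext i
    by_cases hi : i = k
    · subst hi; tauto
    · exact (hlt i hi).symm
  · rintro ⟨rfl, h⟩
    ext i
    by_cases hi : i = k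
    · subst hi; tauto
    · exact hlt i hi

theorem sum_Ico_choose_sub {n k s : ℕ} (hkn : k + 1 ≤ n) (hs : s ≤ k) :
    ∑ j ∈ Ico s (k + 1), (n - (j + 1)).choose (k - j) = (n - s).choose (k - s) := by
  induction hs using Nat.decreasingInduction with
  | self => simp
  | of_succ s hs ih =>
    rw [sum_eq_sum_Ico_succ_bot (by omega), ih, show n - s = n - (s + 1) + 1 by omega,
      show k - s = k - (s + 1) + 1 by omega, Nat.choose_succ_succ', add_comm]

theorem sum_descSet_choose_succ {n k : ℕ} (hk : 1 ≤ k) (hkn : k + 1 ≤ n) {D : Finset ℕ}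
    (hD : D ⊆ Icc 1 (k - 1)) :
    ∑ σ ∈ (univ : Finset (Equiv.Perm (Fin (k + 1)))).filter (fun σ => descSet (k + 1) σ = D),
        (n - oneline (k + 1) σ (k + 1)).choose (k + 1 - oneline (k + 1) σ (k + 1))
      = ∑ σ ∈ (univ : Finset (Equiv.Perm (Fin k))).filter (fun σ => descSet k σ = D),
        (n - oneline k σ k).choose (k - oneline k σ k) := by
  rw [sum_filter, ← (appendLast_bijective k).sum_comp, Fintype.sum_prod_type_right, sum_filter]
  refine sum_congr rfl fun σ _ => ?_
  simp only [descSet_appendLast_eq_iff hk hD, oneline_appendLast_last, Nat.add_sub_add_right]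
  split_ifs with h
  · rw [← sum_Ico_choose_sub hkn (oneline_le σ k),
      Fin.sum_univ_eq_sum_range (fun j => if descSet k σ = D ∧ oneline k σ k ≤ j then
        (n - (j + 1)).choose (k - j) else 0), ← sum_filter]
    refine sum_congr ?_ fun _ _ => rfl
    ext j
    simp [h, and_comm]
  · simp [h]

/-- For `1 ≤ k ≤ n` and `D ⊆ {1,…,k-1}`:
`E(n, D) = Σ_{σ ∈ S_k, Des(σ) = D} binom(n - σ(k), k - σ(k))`. -/
theorem eulerianCount_eq_sum_binomial (n k : ℕ) (hk : 1 ≤ k) (hkn : k ≤ n)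
    (D : Finset ℕ) (hD : D ⊆ Finset.Icc 1 (k - 1)) :
    eulerianCount n D
      = ∑ σ ∈ (Finset.univ : Finset (Equiv.Perm (Fin k))).filter
          (fun σ => descSet k σ = D),
        (n - oneline k σ k).choose (k - oneline k σ k) := by
  induction hkn using Nat.decreasingInduction with
  | self =>
    simp [eulerianCount]
  | of_succ k hkn ih =>
    rw [ih (by omega) (hD.trans (Icc_subset_Icc_right (by omega))),
      sum_descSet_choose_succ hk hkn hD]
end

section
/- For integers 1 ≤ k ≤ n, the following identity holds in the multivariate polynomial ring ℤ[x_1,…,x_{k−1}]: Σ_{I ⊆ {1,…,k}, 1 ∈ I} binom(n, ΔI) · ∏_{i ∈ I, i ≠ 1} x_{i−1} = Σ_{D ∈ nc(k−1), 1 ∉ D} E(n,D) · (∏_{i ∈ D} x_i) · (∏_{i ∈ {1,…,k−1}, i ∉ D, i+1 ∉ D} (1+x_i)). (Both sides equal the multivariate Chow polynomial of the uniform matroid U_{k,n}.) -/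
open Finset Polynomial

/-- A permutation factors uniquely as one that is increasing on the level sets of a monotone
function `c` times one that preserves `c`. -/
theorem card_increasing_mul_card_stabilizer {n : ℕ} {c : Fin n → ℕ} (hc : Monotone c) :
    (univ.filter fun w : Equiv.Perm (Fin n) => Monotone fun i => toLex (c i, w i)).card
      * Fintype.card {g : Equiv.Perm (Fin n) // c ∘ g = c} = n.factorial := by
  classical
  have hn : (univ : Finset (Equiv.Perm (Fin n))).card = n.factorial := by
    rw [Finset.card_univ, Fintype.card_perm, Fintype.card_fin]
  rw [← hn, Fintype.card_subtype, ← card_product]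
  refine card_bij (fun p _ => p.1 * p.2) (fun _ _ => mem_univ _) ?_ ?_
  · rintro ⟨w, y⟩ hp ⟨w', y'⟩ hp' h
    simp only [mem_product, mem_filter, mem_univ, true_and] at hp hp' h
    obtain ⟨hw, hy⟩ := hp
    obtain ⟨hw', hy'⟩ := hp'
    have hcomp : (fun i => toLex (c i, w i)) ∘ (y * y'⁻¹ : Equiv.Perm (Fin n))
        = fun i => toLex (c i, w' i) := by
      funext i
      have h1 : w (y (y'⁻¹ i)) = w' i := by
        have := congrArg (fun σ : Equiv.Perm (Fin n) => σ (y'⁻¹ i)) h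
        simpa using this
      have h2 : c (y (y'⁻¹ i)) = c i := by
        have e1 := congrFun hy (y'⁻¹ i)
        have e2 := congrFun hy' (y'⁻¹ i)
        have e3 : y' (y'⁻¹ i) = i := by simp
        simp only [Function.comp_apply, e3] at e1 e2
        rw [e1, e2]
      simp only [Function.comp_apply, Equiv.Perm.mul_apply, h1, h2]
    have huniq := Tuple.unique_monotone (f := fun i => toLex (c i, w i))
      (σ := 1) (τ := y * y'⁻¹) (by simpa using hw) (by rw [hcomp]; exact hw')
    rw [hcomp] at huniq
    have hww : w = w' := by
      ext i
      have := congrFun huniq i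
      simp only [Function.comp_apply, Equiv.Perm.one_apply, EmbeddingLike.apply_eq_iff_eq,
        Prod.mk.injEq] at this
      rw [this.2]
    subst hww
    simpa using h
  · intro w _
    let f : Fin n → ℕ ×ₗ Fin n := fun i => toLex (c i, w i)
    have hf : Monotone (f ∘ Tuple.sort f) := Tuple.monotone_sort f
    have hcs : c ∘ Tuple.sort f = c := by
      have hm : Monotone (c ∘ Tuple.sort f) := fun i j hij =>
        Prod.Lex.monotone_fst _ _ (hf hij)
      simpa using Tuple.unique_monotone (f := c) (σ := Tuple.sort f) (τ := 1) hm (by simpa using hc)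
    refine ⟨(w * Tuple.sort f, (Tuple.sort f)⁻¹), ?_, by simp⟩
    simp only [mem_product, mem_filter, mem_univ, true_and]
    constructor
    · convert hf using 1
      funext i
      have := congrFun hcs i
      simp only [Function.comp_apply] at this
      simp [f, this]
    · funext i
      have := congrFun hcs ((Tuple.sort f)⁻¹ i)
      simpa using this.symm

theorem countP_le_mono (L : List ℕ) {a b : ℕ} (h : a ≤ b) :
    L.countP (· ≤ a) ≤ L.countP (· ≤ b) :=
  List.countP_mono_left fun x _ hx => by simp only [decide_eq_true_eq] at hx ⊢; omega

theorem countP_le_lt_countP_le_succ_iff (L : List ℕ) (a : ℕ) :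
    L.countP (· ≤ a) < L.countP (· ≤ a + 1) ↔ a + 1 ∈ L := by
  induction L with
  | nil => simp
  | cons m L ih =>
    have h := countP_le_mono L (Nat.le_add_right a 1)
    simp only [List.countP_cons, List.mem_cons, decide_eq_true_eq]
    split_ifs <;> grind

theorem mem_descSet {n : ℕ} {w : Equiv.Perm (Fin n)} {d : ℕ} :
    d ∈ descSet n w ↔ (1 ≤ d ∧ d < n) ∧ oneline n w (d + 1) < oneline n w d := by
  rw [descSet, mem_filter, mem_Ico]

theorem monotone_toLex_countP_iff {n : ℕ} (L : List ℕ) (w : Equiv.Perm (Fin n)) :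
    (Monotone fun i : Fin n => toLex (L.countP (· ≤ (i : ℕ) + 1), w i))
      ↔ ∀ d ∈ descSet n w, d + 1 ∈ L := by
  cases n with
  | zero => simp [descSet, Subsingleton.monotone]
  | succ m =>
    rw [Fin.monotone_iff_le_succ]
    simp only [Prod.Lex.toLex_le_toLex, Fin.val_castSucc, Fin.val_succ,
      countP_le_lt_countP_le_succ_iff, mem_descSet]
    constructor
    · rintro h d ⟨⟨h1, h2⟩, h3⟩
      obtain ⟨e, rfl⟩ : ∃ e, d = e + 1 := ⟨d - 1, by omega⟩
      rcases h ⟨e, by omega⟩ with h | h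
      · exact h
      · exfalso
        have h4 := h.2
        simp only [oneline, Nat.add_sub_cancel, h2, show e < m + 1 by omega, dite_true] at h3
        rw [Fin.le_def] at h4
        simp only [Fin.castSucc_mk, Fin.succ_mk] at h4
        omega
    · intro h i
      by_cases hi : (i : ℕ) + 1 + 1 ∈ L
      · exact Or.inl hi
      · right
        constructor
        · have h1 := countP_le_mono L (Nat.le_add_right ((i : ℕ) + 1) 1)
          have h2 := mt (countP_le_lt_countP_le_succ_iff L ((i : ℕ) + 1)).1 hi
          omega
        · by_contra hlt
          refine hi (h ((i : ℕ) + 1) ⟨⟨by omega, by omega⟩, ?_⟩)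
          have h1 : (i : ℕ) + 1 < m + 1 := by omega
          have h2 : (i : ℕ) < m + 1 := by omega
          simp only [oneline, Nat.add_sub_cancel, h1, h2, dite_true]
          rw [not_le, Fin.lt_def] at hlt
          exact Nat.succ_lt_succ hlt

theorem prod_factorial_card_countP (N : ℕ) (L : List ℕ) (p : ℕ) (hp : ∀ m ∈ L, p ≤ m)
    (hN : ∀ m ∈ L, m ≤ N) (hL : L.Pairwise (· < ·)) :
    ∏ j ∈ range (L.length + 1), ((Ico p N).filter fun i => L.countP (· ≤ i) = j).card.factorial
      = ((diffList N p L).map Nat.factorial).prod := by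
  induction L generalizing p with
  | nil => simp [diffList]
  | cons m L ih =>
    rw [List.pairwise_cons] at hL
    have hm : ∀ x ∈ L, m ≤ x := fun x hx => (hL.1 x hx).le
    have hzero : ∀ i < m, L.countP (· ≤ i) = 0 := by
      intro i hi
      rw [List.countP_eq_zero]
      intro x hx
      have := hm x hx
      simp only [decide_eq_true_eq]
      omega
    have hpm := hp m List.mem_cons_self
    have hmN := hN m List.mem_cons_self
    rw [diffList, List.map_cons, List.prod_cons, List.length_cons, prod_range_succ', mul_comm,
      ← ih m hm (fun x hx => hN x (List.mem_cons_of_mem _ hx)) hL.2]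
    congr 1
    · rw [show (Ico p N).filter (fun i => (m :: L).countP (· ≤ i) = 0) = Ico p m from ?_,
        Nat.card_Ico]
      ext i
      simp only [mem_filter, mem_Ico, List.countP_cons, decide_eq_true_eq]
      have := hzero i
      grind
    · refine prod_congr rfl fun j _ => ?_
      congr 2
      ext i
      simp only [mem_filter, mem_Ico, List.countP_cons, decide_eq_true_eq]
      have := hzero i
      grind

/-- The multinomial coefficient counts the permutations whose descents lie at prescribed
positions. -/
theorem factorial_div_diffList (n : ℕ) (L : List ℕ) (h1 : ∀ m ∈ L, 1 ≤ m)
    (hn : ∀ m ∈ L, m ≤ n + 1) (hL : L.Pairwise (· < ·)) :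
    n.factorial / ((diffList (n + 1) 1 L).map Nat.factorial).prod
      = (univ.filter fun w : Equiv.Perm (Fin n) => ∀ d ∈ descSet n w, d + 1 ∈ L).card := by
  let c : Fin n → ℕ := fun i => L.countP (· ≤ (i : ℕ) + 1)
  have hc : Monotone c := fun i j hij => countP_le_mono L (Nat.succ_le_succ hij)
  have hstab : Fintype.card {g : Equiv.Perm (Fin n) // c ∘ g = c}
      = ((diffList (n + 1) 1 L).map Nat.factorial).prod := by
    rw [← prod_factorial_card_countP (n + 1) L 1 h1 hn hL, DomMulAct.stabilizer_card']
    have hfib : ∀ j, Fintype.card {a // c a = j}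
        = ((Ico 1 (n + 1)).filter fun i => L.countP (· ≤ i) = j).card := by
      intro j
      rw [Fintype.card_subtype]
      refine card_bij (fun a _ => (a : ℕ) + 1) ?_ ?_ ?_
      · intro a ha
        simp only [mem_filter, mem_univ, true_and, c] at ha
        simp only [mem_filter, mem_Ico]
        exact ⟨by omega, ha⟩
      · intro a _ b _ hab
        exact Fin.ext (Nat.succ_injective hab)
      · intro b hb
        simp only [mem_filter, mem_Ico] at hb
        refine ⟨⟨b - 1, by omega⟩, ?_, by simp only; omega⟩
        simp only [mem_filter, mem_univ, true_and, c, Nat.sub_add_cancel hb.1.1]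
        exact hb.2
    simp only [← hfib]
    refine prod_subset ?_ ?_
    · intro j hj
      obtain ⟨a, _, rfl⟩ := mem_image.1 hj
      exact mem_range.2 (Nat.lt_succ_of_le List.countP_le_length)
    · intro j _ hj
      have : IsEmpty {a // c a = j} :=
        ⟨fun a => hj (mem_image.2 ⟨a.1, mem_univ _, a.2⟩)⟩
      simp
  have hmul := card_increasing_mul_card_stabilizer hc
  rw [hstab] at hmul
  simp only [c, monotone_toLex_countP_iff] at hmul
  rw [← hmul, Nat.mul_div_cancel]
  rw [← hstab]
  exact Fintype.card_pos_iff.2 ⟨⟨1, rfl⟩⟩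

/-- For `I ⊆ {1,…,k}`, the coefficient `binom(n, ΔI)` sums `E(n, D)` over the sets
`D` such that each `d + 1`, `d ∈ D`, starts a block of `I`. -/
theorem binomDelta_eq_sum_eulerianCount {n k : ℕ} (hkn : k ≤ n) {I : Finset ℕ}
    (hI : I ⊆ Icc 1 k) :
    binomDelta n I = ∑ D ∈ ((Icc 1 (k - 1)).filter fun d => d + 1 ∈ I ∧ d ∉ I).powerset,
      eulerianCount n D := by
  have hI' : ∀ i ∈ I, 1 ≤ i ∧ i ≤ k := fun i hi => mem_Icc.1 (hI hi)
  have hmem : ∀ m, m ∈ blockMinima I ↔ m ∈ I ∧ m - 1 ∉ I := by simp [blockMinima]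
  rw [binomDelta, factorial_div_diffList n (blockMinima I)
    (fun m hm => (hI' m ((hmem m).1 hm).1).1)
    (fun m hm => by have := (hI' m ((hmem m).1 hm).1).2; omega)
    (sortedLT_sort _).pairwise, card_eq_sum_card_fiberwise (f := descSet n)
    (t := ((Icc 1 (k - 1)).filter fun d => d + 1 ∈ I ∧ d ∉ I).powerset)]
  · refine sum_congr rfl fun D hD => ?_
    rw [eulerianCount, filter_filter]
    congr 1
    refine filter_congr fun w _ => ?_
    rw [and_iff_right_iff_imp]
    rintro rfl d hd
    have := (mem_filter.1 (mem_powerset.1 hD hd)).2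
    rw [hmem]
    exact this
  · intro w hw
    have hw' := (mem_filter.1 (mem_coe.1 hw)).2
    refine mem_coe.2 (mem_powerset.2 fun d hd => ?_)
    have hd' := (hmem _).1 (hw' d hd)
    have hd1 : 1 ≤ d := (mem_Ico.1 (mem_filter.1 hd).1).1
    have := hI' _ hd'.1
    exact mem_filter.2 ⟨mem_Icc.2 ⟨hd1, by omega⟩, hd'⟩

open MvPolynomial in
/-- For `1 ≤ k ≤ n`, in `ℤ[x₁,…,x_{k-1}]`:
`Σ_{I ⊆ {1,…,k}, 1 ∈ I} binom(n, ΔI) ∏_{i ∈ I, i ≠ 1} x_{i-1}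
  = Σ_{D ∈ nc(k-1), 1 ∉ D} E(n,D) (∏_{i ∈ D} x_i) ∏_{i ∈ {1,…,k-1}, i ∉ D, i+1 ∉ D} (1 + x_i)`. -/
theorem multivariate_chow_uniform (n k : ℕ) (hk : 1 ≤ k) (hkn : k ≤ n) :
    ∑ I ∈ (Finset.Icc 1 k).powerset.filter (fun I => 1 ∈ I),
      (binomDelta n I : MvPolynomial ℕ ℤ) * ∏ i ∈ I.erase 1, X (i - 1)
    = ∑ D ∈ (Finset.Icc 1 (k - 1)).powerset.filter
        (fun D => (∀ i ∈ D, i + 1 ∉ D) ∧ 1 ∉ D),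
      (eulerianCount n D : MvPolynomial ℕ ℤ) * (∏ i ∈ D, X i)
        * ∏ i ∈ (Finset.Icc 1 (k - 1)).filter (fun i => i ∉ D ∧ i + 1 ∉ D),
            (1 + X i) := by
  have hL : ∀ I ∈ (Finset.Icc 1 k).powerset.filter (fun I => 1 ∈ I),
      (binomDelta n I : MvPolynomial ℕ ℤ) * ∏ i ∈ I.erase 1, X (i - 1)
      = ∑ D ∈ ((Icc 1 (k - 1)).filter fun d => d + 1 ∈ I ∧ d ∉ I).powerset,
        (eulerianCount n D : MvPolynomial ℕ ℤ) * ∏ i ∈ I.erase 1, X (i - 1) := by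
    intro I hI
    rw [binomDelta_eq_sum_eulerianCount hkn (mem_powerset.1 (mem_filter.1 hI).1), Nat.cast_sum,
      sum_mul]
  have hR : ∀ D ∈ (Finset.Icc 1 (k - 1)).powerset.filter
        (fun D => (∀ i ∈ D, i + 1 ∉ D) ∧ 1 ∉ D),
      (eulerianCount n D : MvPolynomial ℕ ℤ) * (∏ i ∈ D, X i)
        * ∏ i ∈ (Finset.Icc 1 (k - 1)).filter (fun i => i ∉ D ∧ i + 1 ∉ D), (1 + X i)
      = ∑ T ∈ ((Finset.Icc 1 (k - 1)).filter (fun i => i ∉ D ∧ i + 1 ∉ D)).powerset,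
        (eulerianCount n D : MvPolynomial ℕ ℤ) * (∏ i ∈ D, X i) * ∏ i ∈ T, X i := by
    intro D _
    rw [prod_one_add, mul_sum]
  rw [sum_congr rfl hL, sum_congr rfl hR, sum_sigma', sum_sigma']
  refine sum_bij' (fun p _ => ⟨p.2, ((p.1.erase 1).image (· - 1)) \ p.2⟩)
    (fun q _ => ⟨insert 1 ((q.1 ∪ q.2).image (· + 1)), q.1⟩) ?_ ?_ ?_ ?_ ?_
  · rintro ⟨I, D⟩ h
    simp only [mem_sigma, mem_filter, mem_powerset, subset_iff, mem_Icc, mem_sdiff, mem_image,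
      mem_erase] at h ⊢
    obtain ⟨⟨hI, h1⟩, hD⟩ := h
    refine ⟨⟨fun d hd => (hD hd).1, fun d hd hd' => (hD hd').2.2 (hD hd).2.1,
      fun hd => (hD hd).2.2 h1⟩, ?_⟩
    rintro _ ⟨⟨i, ⟨hi1, hi⟩, rfl⟩, hiD⟩
    have := hI hi
    refine ⟨by omega, hiD, fun hd => (hD hd).2.2 ?_⟩
    rwa [Nat.sub_add_cancel this.1]
  · rintro ⟨D, T⟩ h
    simp only [mem_sigma, mem_filter, mem_powerset, subset_iff, mem_Icc, mem_union, mem_image,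
      mem_insert] at h ⊢
    grind
  · rintro ⟨I, D⟩ h
    simp only [mem_sigma, mem_filter, mem_powerset, subset_iff, mem_Icc] at h
    simp only [Sigma.mk.injEq, heq_eq_eq, and_true]
    ext i
    simp only [mem_insert, mem_image, mem_union, mem_sdiff, mem_erase]
    constructor
    · grind
    · intro hi
      by_cases hi1 : i = 1
      · exact Or.inl hi1
      · have := h.1.1 hi
        have hpred : i - 1 + 1 = i := by omega
        by_cases hD : i - 1 ∈ D
        · exact Or.inr ⟨i - 1, Or.inl hD, hpred⟩
        · exact Or.inr ⟨i - 1, Or.inr ⟨⟨i, ⟨hi1, hi⟩, rfl⟩, hD⟩, hpred⟩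
  · rintro ⟨D, T⟩ h
    simp only [mem_sigma, mem_filter, mem_powerset, subset_iff, mem_Icc] at h
    simp only [Sigma.mk.injEq, heq_eq_eq, true_and]
    ext i
    simp only [mem_insert, mem_image, mem_union, mem_sdiff, mem_erase]
    constructor
    · grind
    · intro hi
      have := h.2 hi
      exact ⟨⟨i + 1, ⟨by omega, Or.inr ⟨i, Or.inr hi, rfl⟩⟩, rfl⟩, this.2.1⟩
  · rintro ⟨I, D⟩ h
    simp only [mem_sigma, mem_filter, mem_powerset, subset_iff, mem_Icc] at h
    have hinj : Set.InjOn (· - 1) (I.erase 1 : Set ℕ) := by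
      intro a ha b hb hab
      simp only [coe_erase, Set.mem_sdiff, mem_coe] at ha hb
      have := h.1.1 ha.1
      have := h.1.1 hb.1
      simp only at hab
      omega
    have hsub : D ⊆ (I.erase 1).image (· - 1) := by
      intro d hd
      have := h.2 hd
      exact mem_image.2 ⟨d + 1, mem_erase.2 ⟨by omega, this.2.1⟩, rfl⟩
    simp only
    rw [mul_assoc, mul_comm (∏ i ∈ D, X i), prod_sdiff hsub, prod_image hinj]
end

section
/- Let n ≥ 1, let I ⊆ [n] be nonempty with |I| = k, and let c be an integer with k ≤ c ≤ n. Then every subset S ⊆ [n] with |S| = c contains a subset J with |J| = k and I ≤ J (componentwise in the standard order, after sorting) if and only if max(I) ≤ c. -/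
open Finset

/-- `I ≤ J` in the standard (Gale) order on subsets of `ℕ`: listing `I` and `J`
increasingly, each element of `I` is at most the corresponding element of `J`
(this forces `|I| = |J|`). -/
def natDom (I J : Finset ℕ) : Prop :=
  List.Forall₂ (· ≤ ·) (I.sort (· ≤ ·)) (J.sort (· ≤ ·))

/-- If `List.Forall₂ R l m`, then every element of `l` is related to some element
of `m`. -/
theorem List.Forall₂.exists_mem_right {α β : Type*} {R : α → β → Prop} {l : List α}
    {m : List β} (h : List.Forall₂ R l m) {a : α} (ha : a ∈ l) : ∃ b ∈ m, R a b := by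
  induction h with
  | nil => simp at ha
  | cons hab _ ih =>
    rcases List.mem_cons.1 ha with rfl | ha
    · exact ⟨_, List.mem_cons_self, hab⟩
    · obtain ⟨b, hb, hR⟩ := ih ha
      exact ⟨b, List.mem_cons_of_mem _ hb, hR⟩

/-- If `natDom I J`, then every element of `I` is bounded by an element of `J`. -/
theorem natDom.exists_le {I J : Finset ℕ} (h : natDom I J) {i : ℕ} (hi : i ∈ I) :
    ∃ j ∈ J, i ≤ j := by
  obtain ⟨j, hj, hij⟩ := h.exists_mem_right ((Finset.mem_sort _).2 hi)
  exact ⟨j, (Finset.mem_sort _).1 hj, hij⟩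

/-- The image of `I` under a map `f` strictly monotone on `I` with `i ≤ f i` for `i ∈ I`
dominates `I`. -/
theorem natDom_image {I : Finset ℕ} {f : ℕ → ℕ} (hf : StrictMonoOn f I)
    (hle : ∀ i ∈ I, i ≤ f i) : natDom I (I.image f) := by
  have hsort : (I.image f).sort (· ≤ ·) = (I.sort (· ≤ ·)).map f := by
    have hlt : ((I.sort (· ≤ ·)).map f).Pairwise (· < ·) := by
      rw [List.pairwise_map]
      refine (Finset.sortedLT_sort I).pairwise.imp_of_mem fun ha hb hab => hf ?_ ?_ hab
      · simpa using ha
      · simpa using hb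
    have himage : I.image f = ((I.sort (· ≤ ·)).map f).toFinset := by
      ext x
      simp
    rw [himage]
    exact (List.toFinset_sort (· ≤ ·) (hlt.imp ne_of_lt)).2 (hlt.imp le_of_lt)
  rw [natDom, hsort, List.forall₂_map_right_iff, List.forall₂_same]
  exact fun i hi => hle i ((Finset.mem_sort _).1 hi)

/-- A strictly monotone map from `Fin c` to the positive integers satisfies `i < e i`. -/
theorem lt_of_strictMono_of_pos {c : ℕ} {e : Fin c → ℕ} (he : StrictMono e)
    (hpos : ∀ i, 0 < e i) (i : Fin c) : (i : ℕ) < e i := by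
  obtain ⟨i, hi⟩ := i
  induction i with
  | zero => exact hpos _
  | succ i ih =>
    have hstep : e ⟨i, by omega⟩ < e ⟨i + 1, hi⟩ := he (by simp [Fin.lt_def])
    have := ih (by omega)
    simp only at this ⊢
    omega

/-- Let `I ⊆ [n]` be nonempty with `|I| = k` and `k ≤ c ≤ n`.
Every `S ⊆ [n]` with `|S| = c` contains some `J` with `|J| = k` and `I ≤ J`
iff `max I ≤ c`. -/
theorem forall_subset_contains_dominating_iff_max_le (n k c : ℕ) (hn : 1 ≤ n)
    (I : Finset ℕ) (hI : I ⊆ Finset.Icc 1 n) (hne : I.Nonempty)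
    (hcard : I.card = k) (hkc : k ≤ c) (hcn : c ≤ n) :
    (∀ S : Finset ℕ, S ⊆ Finset.Icc 1 n → S.card = c →
        ∃ J ⊆ S, J.card = k ∧ natDom I J)
      ↔ I.max' hne ≤ c := by
  subst hcard
  constructor
  · intro h
    obtain ⟨J, hJ, -, hdom⟩ := h (Finset.Icc 1 c) (Finset.Icc_subset_Icc_right hcn) (by simp)
    obtain ⟨j, hj, hij⟩ := hdom.exists_le (I.max'_mem hne)
    exact hij.trans (Finset.mem_Icc.1 (hJ hj)).2
  · intro hmax S hS hSc
    let e := S.orderEmbOfFin hSc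
    have hmem : ∀ i, e i ∈ S := S.orderEmbOfFin_mem hSc
    have hlt := lt_of_strictMono_of_pos e.strictMono
      fun i => (Finset.mem_Icc.1 (hS (hmem i))).1
    let f : ℕ → ℕ := fun x => if h : x - 1 < c then e ⟨x - 1, h⟩ else 0
    have hI1 : ∀ i ∈ I, 1 ≤ i := fun i hi => (Finset.mem_Icc.1 (hI hi)).1
    have hIc : ∀ i ∈ I, i - 1 < c := fun i hi => by
      have := hI1 i hi
      have := I.le_max' i hi
      omega
    have hf : ∀ i (hi : i ∈ I), f i = e ⟨i - 1, hIc i hi⟩ := fun i hi => dif_pos (hIc i hi)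
    have hmono : StrictMonoOn f I := fun a ha b hb hab => by
      rw [hf a ha, hf b hb]
      have := hI1 a ha
      exact e.strictMono (Fin.mk_lt_mk.2 (by omega))
    refine ⟨I.image f, ?_, Finset.card_image_of_injOn hmono.injOn, natDom_image hmono ?_⟩
    · intro x hx
      obtain ⟨i, hi, rfl⟩ := Finset.mem_image.1 hx
      rw [hf i hi]
      exact hmem _
    · intro i hi
      rw [hf i hi]
      have := hlt ⟨i - 1, hIc i hi⟩
      simp only at this
      omega
end

section
/- Let n ≥ 1 and let I ⊆ [n] be nonempty. The number of distinct families of sets of the form B_{π(I),π} = {J ⊆ [n] : |J| = |I|, π(I) ≤_π J}, as π ranges over S_n (where π(I) = {π(i) : i ∈ I}), equals the multinomial coefficient binom(n, ΔI). Equivalently, the orbit of the Schubert matroid S_{I,id} under the S_n-action τ ∗ S_{I,π} = S_{τ(I),τπ} has size binom(n, ΔI). -/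
open Finset

/-- The total order `≤_π` on `{1,…,n}` determined by `π ∈ S_n`:
`π(1) ≤_π π(2) ≤_π … ≤_π π(n)`. -/
def piLE {n : ℕ} (π : Equiv.Perm (Fin n)) (a b : Fin n) : Prop :=
  π.symm a ≤ π.symm b

instance {n : ℕ} (π : Equiv.Perm (Fin n)) : DecidableRel (piLE π) :=
  fun a b => inferInstanceAs (Decidable (π.symm a ≤ π.symm b))

instance {n : ℕ} (π : Equiv.Perm (Fin n)) : IsTrans (Fin n) (piLE π) :=
  ⟨fun _ _ _ h₁ h₂ => le_trans h₁ h₂⟩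

instance {n : ℕ} (π : Equiv.Perm (Fin n)) : IsAntisymm (Fin n) (piLE π) :=
  ⟨fun _ _ h₁ h₂ => π.symm.injective (le_antisymm h₁ h₂)⟩

instance {n : ℕ} (π : Equiv.Perm (Fin n)) : IsTotal (Fin n) (piLE π) :=
  ⟨fun a b => le_total (π.symm a) (π.symm b)⟩

/-- The elements of `I`, listed increasingly with respect to `≤_π`. -/
def piSort {n : ℕ} (π : Equiv.Perm (Fin n)) (I : Finset (Fin n)) : List (Fin n) :=
  I.sort (piLE π)

/-- `I ≤_π J`: listing `I` and `J` increasingly with respect to `≤_π`, each element of `I`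
is `≤_π` the corresponding element of `J` (this forces `|I| = |J|`). -/
def piDom {n : ℕ} (π : Equiv.Perm (Fin n)) (I J : Finset (Fin n)) : Prop :=
  List.Forall₂ (piLE π) (piSort π I) (piSort π J)

instance {n : ℕ} (π : Equiv.Perm (Fin n)) (I J : Finset (Fin n)) :
    Decidable (piDom π I J) :=
  inferInstanceAs (Decidable (List.Forall₂ _ _ _))

/-- The set of bases `B_{I,π} = {J ⊆ [n] : |J| = |I|, I ≤_π J}` of the Schubert
matroid `S_{I,π}`. -/
def schubertBases {n : ℕ} (π : Equiv.Perm (Fin n)) (I : Finset (Fin n)) :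
    Finset (Finset (Fin n)) :=
  Finset.univ.filter fun J => J.card = I.card ∧ piDom π I J

theorem List.forall₂_le_iff_countP_lt_le {α : Type*} (g : α → ℕ) :
    ∀ {l₁ l₂ : List α}, l₁.Pairwise (fun a b => g a ≤ g b) →
      l₂.Pairwise (fun a b => g a ≤ g b) → l₁.length = l₂.length →
      (List.Forall₂ (fun a b => g a ≤ g b) l₁ l₂ ↔
        ∀ t, l₂.countP (fun a => g a < t) ≤ l₁.countP (fun a => g a < t))
  | [], [], _, _, _ => by simp
  | [], _ :: _, _, _, h => by simp at h
  | _ :: _, [], _, _, h => by simp at h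
  | a :: l₁, b :: l₂, h₁, h₂, h => by
    rw [List.pairwise_cons] at h₁ h₂
    have ih := List.forall₂_le_iff_countP_lt_le g h₁.2 h₂.2 (by simpa using h)
    rw [List.forall₂_cons, ih]
    simp only [List.countP_cons, decide_eq_true_eq]
    constructor
    · rintro ⟨hab, hl⟩ t
      have := hl t
      split_ifs <;> omega
    · intro H
      have hab : g a ≤ g b := by
        by_contra! hba
        have h0 : l₁.countP (fun c => g c < g a) = 0 := by
          simpa [List.countP_eq_zero] using h₁.1
        have := H (g a)
        simp [h0, hba] at this
      refine ⟨hab, fun t => ?_⟩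
      by_cases hb : g b < t
      · have := H t
        simpa [hb, hab.trans_lt hb] using this
      · have h0 : l₂.countP (fun c => g c < t) = 0 := by
          simp only [List.countP_eq_zero, decide_eq_true_eq]
          intro c hc
          have := h₂.1 c hc
          omega
        omega

/-- `J` dominates `I` in the Gale order of `Fin n`. -/
def GaleDom {n : ℕ} (I J : Finset (Fin n)) : Prop :=
  #J = #I ∧ ∀ t : ℕ, #{x ∈ J | x.val < t} ≤ #{x ∈ I | x.val < t}

theorem countP_piSort {n : ℕ} (π : Equiv.Perm (Fin n)) (J : Finset (Fin n))
    (p : Fin n → Prop) [DecidablePred p] :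
    (piSort π J).countP (fun a => p a) = #{x ∈ J | p x} := by
  have h : ((piSort π J : List (Fin n)) : Multiset (Fin n)) = J.val := Finset.sort_eq _ _
  rw [← Multiset.coe_countP, h, Multiset.countP_eq_card_filter]
  rfl

theorem mem_schubertBases_image {n : ℕ} (π : Equiv.Perm (Fin n)) (I J : Finset (Fin n)) :
    J ∈ schubertBases π (I.image π) ↔ GaleDom I (J.image π.symm) := by
  have hc : #(J.image π.symm) = #J := card_image_of_injective _ π.symm.injective
  have hI : #(I.image π) = #I := card_image_of_injective _ π.injective
  simp only [schubertBases, mem_filter, mem_univ, true_and, GaleDom, hc, hI]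
  refine and_congr_right fun hcard => ?_
  have hs : ∀ K : Finset (Fin n),
      (piSort π K).Pairwise (fun a b => (π.symm a).val ≤ (π.symm b).val) :=
    fun K => Finset.pairwise_sort K (piLE π)
  have hl : (piSort π (I.image π)).length = (piSort π J).length := by
    simp [piSort, hI, hcard]
  refine (List.forall₂_le_iff_countP_lt_le (fun a => (π.symm a).val) (hs _) (hs _) hl).trans ?_
  refine forall_congr' fun t => ?_
  rw [countP_piSort π J (fun a => (π.symm a).val < t),
    countP_piSort π (I.image π) (fun a => (π.symm a).val < t),
    filter_image, filter_image, card_image_of_injective _ π.injective,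
    card_image_of_injective _ π.symm.injective]
  simp

/-- `m` is the minimum of a maximal block of consecutive elements of `I`. -/
def IsBlockMin {n : ℕ} (I : Finset (Fin n)) (m : Fin n) : Prop :=
  m ∈ I ∧ ∀ k ∈ I, k.val + 1 ≠ m.val

instance {n : ℕ} (I : Finset (Fin n)) : DecidablePred (IsBlockMin I) :=
  fun m => inferInstanceAs (Decidable (m ∈ I ∧ ∀ k ∈ I, k.val + 1 ≠ m.val))

/-- The number of block minima of `I` that are at most `x`. -/
def blockIndex {n : ℕ} (I : Finset (Fin n)) (x : Fin n) : ℕ :=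
  #{m | IsBlockMin I m ∧ m ≤ x}

theorem blockIndex_mono {n : ℕ} (I : Finset (Fin n)) : Monotone (blockIndex I) :=
  fun _ _ h => card_le_card <| monotone_filter_right _ fun _ _ hm => ⟨hm.1, hm.2.trans h⟩

theorem IsBlockMin.blockIndex_lt_iff {n : ℕ} {I : Finset (Fin n)} {m : Fin n}
    (hm : IsBlockMin I m) (x : Fin n) : blockIndex I x < blockIndex I m ↔ x < m := by
  refine ⟨fun h => (blockIndex_mono I).reflect_lt h, fun h => card_lt_card ?_⟩
  rw [Finset.ssubset_iff_of_subset
    (monotone_filter_right _ fun k _ hk => ⟨hk.1, hk.2.trans h.le⟩)]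
  exact ⟨m, by simp [hm], by simp [h]⟩

theorem exists_isBlockMin_of_blockIndex_lt {n : ℕ} {I : Finset (Fin n)} {x y : Fin n}
    (h : blockIndex I y < blockIndex I x) : ∃ m, IsBlockMin I m ∧ y < m ∧ m ≤ x := by
  by_contra! H
  refine h.not_ge (card_le_card (monotone_filter_right _ fun m _ hm => ⟨hm.1, ?_⟩))
  by_contra! hy
  exact (H m hm.1 hy).not_ge hm.2

/-- Dominance only has to be tested at the block minima. -/
theorem galeDom_iff {n : ℕ} (I J : Finset (Fin n)) :
    GaleDom I J ↔ #J = #I ∧ ∀ m, IsBlockMin I m → #{x ∈ J | x < m} ≤ #{x ∈ I | x < m} := by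
  refine and_congr_right fun hc => ⟨fun h m _ => h m, fun h t => ?_⟩
  induction t with
  | zero => simp
  | succ t ih =>
    by_cases ht : ∃ i ∈ I, i.val = t
    · obtain ⟨i, hi, rfl⟩ := ht
      have hJ : ({x ∈ J | x.val < i.val + 1} : Finset (Fin n)) ⊆
          insert i {x ∈ J | x.val < i.val} := by
        intro x
        simp only [mem_filter, mem_insert, Fin.ext_iff]
        rintro ⟨h1, h2⟩
        by_cases hx : x.val = i.val
        · exact Or.inl hx
        · exact Or.inr ⟨h1, by omega⟩
      have hI : ({x ∈ I | x.val < i.val + 1} : Finset (Fin n)) =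
          insert i {x ∈ I | x.val < i.val} := by
        ext x
        simp only [mem_filter, mem_insert, Fin.ext_iff]
        constructor
        · rintro ⟨h1, h2⟩
          by_cases hx : x.val = i.val
          · exact Or.inl hx
          · exact Or.inr ⟨h1, by omega⟩
        · rintro (h1 | h1)
          · exact ⟨Fin.ext h1 ▸ hi, by omega⟩
          · exact ⟨h1.1, by omega⟩
      rw [hI, card_insert_of_notMem (by simp)]
      exact (card_le_card hJ).trans ((card_insert_le _ _).trans (by omega))
    · push Not at ht
      by_cases hne : ({x ∈ I | t < x.val} : Finset (Fin n)).Nonempty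
      · obtain ⟨hu, htu⟩ := mem_filter.1 (min'_mem _ hne)
        have hmin : ∀ k ∈ I, t < k.val → min' _ hne ≤ k :=
          fun k hk htk => min'_le _ _ (by simp [hk, htk])
        generalize min' _ hne = u at *
        have hum : IsBlockMin I u := by
          refine ⟨hu, fun k hk hku => ?_⟩
          have h1 := ht k hk
          have h2 := hmin k hk (by omega)
          rw [Fin.le_def] at h2
          omega
        refine le_trans (card_le_card ?_) ((h u hum).trans (card_le_card ?_))
        · refine monotone_filter_right _ fun x _ hx => ?_
          rw [Fin.lt_def]
          omega
        · intro x
          simp only [mem_filter]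
          rintro ⟨hx, hxu⟩
          refine ⟨hx, ?_⟩
          by_contra! hxt
          exact (hmin x hx hxt).not_gt hxu
      · rw [filter_true_of_mem (s := I), ← hc]
        · exact card_filter_le _ _
        · intro x hx
          by_contra! hxt
          exact hne ⟨x, by simpa [hx] using hxt⟩

theorem card_filter_insert_erase {α : Type*} [DecidableEq α] {J : Finset α} {x y : α}
    (hx : x ∈ J) (hy : y ∉ J) (p : α → Prop) [DecidablePred p] :
    #{z ∈ insert y (J.erase x) | p z} + (if p x then 1 else 0) =
      #{z ∈ J | p z} + (if p y then 1 else 0) := by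
  have h1 : #{z ∈ J.erase x | p z} + (if p x then 1 else 0) = #{z ∈ J | p z} := by
    rw [filter_erase]
    split_ifs with h
    · exact card_erase_add_one (by simp [hx, h])
    · rw [erase_eq_of_notMem (by simp [h]), add_zero]
  rw [filter_insert, ← h1]
  have hny : y ∉ {z ∈ J.erase x | p z} := by simp [hy]
  split_ifs <;> simp only [card_insert_of_notMem hny]

theorem GaleDom.insert_erase {n : ℕ} {I J : Finset (Fin n)} (hJ : GaleDom I J) {x y : Fin n}
    (hx : x ∈ J) (hy : y ∉ J) (hxy : blockIndex I x ≤ blockIndex I y) :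
    GaleDom I (insert y (J.erase x)) := by
  rw [galeDom_iff] at hJ ⊢
  constructor
  · rw [card_insert_of_notMem (by simp [hy]), card_erase_add_one hx, hJ.1]
  · intro m hm
    have h1 := card_filter_insert_erase hx hy (· < m)
    have h2 := hJ.2 m hm
    have h3 : y < m → x < m := fun h => by
      rw [← hm.blockIndex_lt_iff] at h ⊢
      omega
    split_ifs at h1 <;> omega

theorem exists_galeDom_not_insert_erase {n : ℕ} {I : Finset (Fin n)} {x y : Fin n}
    (h : blockIndex I y < blockIndex I x) :
    ∃ J, GaleDom I J ∧ x ∈ J ∧ y ∉ J ∧ ¬ GaleDom I (insert y (J.erase x)) := by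
  obtain ⟨m, hm, hym, hmx⟩ := exists_isBlockMin_of_blockIndex_lt h
  have hI : GaleDom I I := ⟨rfl, fun _ => le_rfl⟩
  obtain ⟨J₁, hJ₁, hy₁, hm₁, hc₁⟩ : ∃ J, GaleDom I J ∧ y ∉ J ∧ m ∈ J ∧
      #{z ∈ J | z < m} = #{z ∈ I | z < m} := by
    by_cases hy : y ∈ I
    · have hlt : y.val < m.val := hym
      let k : Fin n := ⟨m.val - 1, by omega⟩
      have hkm : k < m := by simp only [Fin.lt_def, k]; omega
      have hkI : k ∉ I := fun hk => hm.2 k hk (by simp only [k]; omega)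
      have hyk : y ≤ k := by simp only [Fin.le_def, k]; omega
      have hne : y ≠ k := fun e => hkI (e ▸ hy)
      refine ⟨insert k (I.erase y), hI.insert_erase hy hkI (blockIndex_mono I hyk),
        by simp [hne], by simp [hm.1, hym.ne'], ?_⟩
      simpa [hkm, hym] using card_filter_insert_erase hy hkI (· < m)
    · exact ⟨I, hI, hy, hm.1, rfl⟩
  obtain ⟨J₂, hJ₂, hy₂, hx₂, hc₂⟩ : ∃ J, GaleDom I J ∧ y ∉ J ∧ x ∈ J ∧
      #{z ∈ J | z < m} = #{z ∈ I | z < m} := by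
    by_cases hx : x ∈ J₁
    · exact ⟨J₁, hJ₁, hy₁, hx, hc₁⟩
    · refine ⟨insert x (J₁.erase m), hJ₁.insert_erase hm₁ hx (blockIndex_mono I hmx),
        by simp [hy₁, (hym.trans_le hmx).ne], by simp, ?_⟩
      rw [← hc₁]
      simpa [hmx.not_gt] using card_filter_insert_erase hm₁ hx (· < m)
  refine ⟨J₂, hJ₂, hx₂, hy₂, fun hJ => ?_⟩
  have h1 := card_filter_insert_erase hx₂ hy₂ (· < m)
  have h2 := ((galeDom_iff _ _).1 hJ).2 m hm
  simp only [hym, hmx.not_gt, if_true, if_false] at h1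
  omega

/-- The block index is recovered from the bases through the exchange preorder. -/
theorem blockIndex_le_iff {n : ℕ} (I : Finset (Fin n)) (x y : Fin n) :
    blockIndex I x ≤ blockIndex I y ↔
      ∀ J, GaleDom I J → x ∈ J → y ∉ J → GaleDom I (insert y (J.erase x)) := by
  refine ⟨fun h J hJ hx hy => hJ.insert_erase hx hy h, fun h => ?_⟩
  by_contra! hlt
  obtain ⟨J, hJ, hx, hy, hn⟩ := exists_galeDom_not_insert_erase hlt
  exact hn (h J hJ hx hy)

theorem comp_perm_eq_of_le_iff_le {α : Type*} [Fintype α] (f : α → ℕ) (g : Equiv.Perm α)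
    (h : ∀ x y, f x ≤ f y ↔ f (g x) ≤ f (g y)) : f ∘ g = f := by
  have hcard : ∀ x, #{y | f y < f (g x)} = #{y | f y < f x} := fun x => by
    refine (card_equiv g fun y => ?_).symm
    have := h x y
    simp only [mem_filter, mem_univ, true_and]
    omega
  have hlt : ∀ x y, f x < f y → #{z | f z < f x} < #{z | f z < f y} := fun x y hxy => by
    refine card_lt_card ((Finset.ssubset_iff_of_subset
      (monotone_filter_right _ fun z _ hz => lt_trans hz hxy)).2 ⟨x, by simp [hxy], by simp⟩)
  funext x
  rcases lt_trichotomy (f (g x)) (f x) with hx | hx | hx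
  · exact absurd (hcard x) (hlt _ _ hx).ne
  · exact hx
  · exact absurd (hcard x) (hlt _ _ hx).ne'

theorem forall_galeDom_image_iff {n : ℕ} (I : Finset (Fin n)) (g : Equiv.Perm (Fin n)) :
    (∀ K, GaleDom I K ↔ GaleDom I (K.image g)) ↔ blockIndex I ∘ g = blockIndex I := by
  constructor
  · intro h
    refine comp_perm_eq_of_le_iff_le _ g fun x y => ?_
    rw [blockIndex_le_iff, blockIndex_le_iff]
    have himg : ∀ J : Finset (Fin n), (insert y (J.erase x)).image g =
        insert (g y) ((J.image g).erase (g x)) := fun J => by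
      rw [image_insert, image_erase g.injective]
    have hmem : ∀ (J : Finset (Fin n)) z, g z ∈ J.image g ↔ z ∈ J := fun J z => by simp
    constructor
    · intro H J
      obtain ⟨J, rfl⟩ : ∃ K : Finset (Fin n), J = K.image g :=
        ⟨J.image g.symm, by simp [image_image]⟩
      rw [← himg, ← h, ← h, hmem, hmem]
      exact H J
    · intro H J
      have := H (J.image g)
      rwa [← himg, ← h, ← h, hmem, hmem] at this
  · intro h K
    rw [galeDom_iff, galeDom_iff, card_image_of_injective _ g.injective]
    refine and_congr_right fun _ => forall_congr' fun m => forall_congr' fun hm => ?_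
    rw [filter_image, card_image_of_injective _ g.injective]
    have : ∀ x, g x < m ↔ x < m := fun x => by
      rw [← hm.blockIndex_lt_iff, ← hm.blockIndex_lt_iff, ← congrFun h x, Function.comp_apply]
    simp only [this]

theorem schubertBases_image_eq_iff {n : ℕ} (I : Finset (Fin n)) (π σ : Equiv.Perm (Fin n)) :
    schubertBases π (I.image π) = schubertBases σ (I.image σ) ↔
      blockIndex I ∘ (σ⁻¹ * π : Equiv.Perm (Fin n)) = blockIndex I := by
  rw [← forall_galeDom_image_iff, Finset.ext_iff]
  simp only [mem_schubertBases_image]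
  constructor
  · intro h K
    simpa [image_image, Function.comp_def] using h (K.image π)
  · intro h J
    simpa [image_image, Function.comp_def] using h (J.image π.symm)

theorem card_image_mul_card_stabilizer {n : ℕ} (I : Finset (Fin n)) :
    #((univ : Finset (Equiv.Perm (Fin n))).image fun π => schubertBases π (I.image π)) *
      #{g : Equiv.Perm (Fin n) | blockIndex I ∘ g = blockIndex I} = n.factorial := by
  have hn : #(univ : Finset (Equiv.Perm (Fin n))) = n.factorial := by
    rw [card_univ, Fintype.card_perm, Fintype.card_fin]
  rw [← hn, card_eq_sum_card_image (fun π => schubertBases π (I.image π)) univ]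
  refine (sum_const_nat fun B hB => ?_).symm
  obtain ⟨σ, -, rfl⟩ := mem_image.1 hB
  refine card_equiv (Equiv.mulLeft σ⁻¹) fun π => ?_
  simp only [mem_filter, mem_univ, true_and, schubertBases_image_eq_iff, Equiv.coe_mulLeft]

theorem prod_factorial_card_fibers_eq_prod_diffList (N : ℕ) :
    ∀ (prev : ℕ) (l : List ℕ), l.Pairwise (· ≤ ·) → (∀ m ∈ l, prev ≤ m ∧ m ≤ N) →
      ∏ k ∈ range (l.length + 1), (#{x ∈ Ico prev N | l.countP (· ≤ x) = k}).factorial =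
        ((diffList N prev l).map Nat.factorial).prod
  | prev, [], _, _ => by simp [diffList]
  | prev, m :: l, hl, hb => by
    rw [List.pairwise_cons] at hl
    have hm := hb m (by simp)
    have ih := prod_factorial_card_fibers_eq_prod_diffList N m l hl.2
      fun k hk => ⟨hl.1 k hk, (hb k (by simp [hk])).2⟩
    have hzero : ∀ x < m, l.countP (· ≤ x) = 0 := fun x hx => by
      simp only [List.countP_eq_zero, decide_eq_true_eq]
      intro k hk
      have := hl.1 k hk
      omega
    have h0 : ({x ∈ Ico prev N | (m :: l).countP (· ≤ x) = 0} : Finset ℕ) = Ico prev m := by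
      ext x
      have := hzero x
      simp only [List.countP_cons, mem_filter, mem_Ico, decide_eq_true_eq]
      grind
    have hs : ∀ k, ({x ∈ Ico prev N | (m :: l).countP (· ≤ x) = k + 1} : Finset ℕ) =
        {x ∈ Ico m N | l.countP (· ≤ x) = k} := fun k => by
      ext x
      have := hzero x
      simp only [List.countP_cons, mem_filter, mem_Ico, decide_eq_true_eq]
      split_ifs <;> omega
    rw [List.length_cons, prod_range_succ', h0, Nat.card_Ico, diffList, List.map_cons,
      List.prod_cons, mul_comm, ← ih]
    simp only [hs]

theorem countP_blockMinima {n : ℕ} (I : Finset (Fin n)) (x : Fin n) :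
    (blockMinima (I.image fun i : Fin n => (i : ℕ) + 1)).countP (· ≤ x.val + 1) =
      blockIndex I x := by
  set A := I.image fun i : Fin n => (i : ℕ) + 1
  have h : ((blockMinima A : List ℕ) : Multiset ℕ) = (A.filter fun i => i - 1 ∉ A).val :=
    Finset.sort_eq _ _
  rw [← Multiset.coe_countP, h, Multiset.countP_eq_card_filter]
  change #((A.filter fun i => i - 1 ∉ A).filter (· ≤ x.val + 1)) = _
  have hinj : Function.Injective fun i : Fin n => (i : ℕ) + 1 := fun i j hij => by
    simpa [Fin.ext_iff] using hij
  rw [blockIndex, ← card_image_of_injective _ hinj]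
  congr 1
  ext a
  simp only [A, mem_filter, mem_image, mem_univ, true_and, IsBlockMin, Fin.le_def]
  constructor
  · rintro ⟨⟨⟨i, hi, rfl⟩, h2⟩, h3⟩
    exact ⟨i, ⟨⟨hi, fun k hk hki => h2 ⟨k, hk, by omega⟩⟩, by omega⟩, rfl⟩
  · rintro ⟨i, ⟨⟨hi, h2⟩, h3⟩, rfl⟩
    exact ⟨⟨⟨i, hi, rfl⟩, fun ⟨k, hk, hki⟩ => h2 k hk (by omega)⟩, by omega⟩

theorem card_stabilizer_blockIndex {n : ℕ} (I : Finset (Fin n)) :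
    #{g : Equiv.Perm (Fin n) | blockIndex I ∘ g = blockIndex I} =
      ((diffList (n + 1) 1 (blockMinima (I.image fun i : Fin n => (i : ℕ) + 1))).map
        Nat.factorial).prod := by
  set l := blockMinima (I.image fun i : Fin n => (i : ℕ) + 1) with hl
  have hlt : ∀ x, blockIndex I x < l.length + 1 := fun x => by
    rw [← countP_blockMinima]
    exact Nat.lt_succ_of_le List.countP_le_length
  let f : Fin n → Fin (l.length + 1) := fun x => ⟨blockIndex I x, hlt x⟩
  have hf : ∀ g : Equiv.Perm (Fin n), f ∘ g = f ↔ blockIndex I ∘ g = blockIndex I := fun g => by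
    simp [funext_iff, f, Fin.ext_iff]
  have hcard := DomMulAct.stabilizer_card f
  rw [Fintype.card_subtype] at hcard
  simp only [hf] at hcard
  rw [hcard, ← prod_factorial_card_fibers_eq_prod_diffList, ← Fin.prod_univ_eq_prod_range
    (fun k => (#{x ∈ Ico 1 (n + 1) | l.countP (· ≤ x) = k}).factorial)]
  · refine prod_congr rfl fun k _ => ?_
    rw [Fintype.card_subtype]
    congr 1
    refine card_bij (fun x _ => x.val + 1) ?_ ?_ ?_
    · intro x hx
      simp only [mem_filter, mem_univ, true_and, f, Fin.ext_iff] at hx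
      rw [mem_filter, mem_Ico]
      exact ⟨by omega, (countP_blockMinima I x).trans hx⟩
    · intro x _ y _ hxy
      exact Fin.ext (by omega)
    · intro b hb
      rw [mem_filter, mem_Ico] at hb
      obtain ⟨a, rfl⟩ : ∃ a, b = a + 1 := ⟨b - 1, by omega⟩
      refine ⟨⟨a, by omega⟩, ?_, rfl⟩
      simp only [mem_filter, mem_univ, true_and, f, Fin.ext_iff]
      rw [← countP_blockMinima]
      exact hb.2
  · exact Finset.pairwise_sort _ _
  · intro m hm
    simp only [hl, blockMinima, mem_sort, mem_filter, mem_image] at hm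
    obtain ⟨⟨i, -, rfl⟩, -⟩ := hm
    omega

/-- For nonempty `I ⊆ [n]`, the number of distinct base families
`B_{π(I),π}` as `π` ranges over `S_n` (the size of the orbit of the Schubert matroid
`S_{I,id}` under `τ ∗ S_{I,π} = S_{τ(I),τπ}`) is the multinomial coefficient
`binom(n, ΔI)`.  (Here `Fin n` represents `[n] = {1,…,n}` via `i ↦ i + 1`.) -/
theorem card_schubert_orbit (n : ℕ) (hn : 1 ≤ n) (I : Finset (Fin n))
    (hI : I.Nonempty) :
    ((Finset.univ : Finset (Equiv.Perm (Fin n))).image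
        (fun π => schubertBases π (I.image π))).card
      = binomDelta n (I.image (fun i : Fin n => (i : ℕ) + 1)) := by
  have hpos : 0 < #{g : Equiv.Perm (Fin n) | blockIndex I ∘ g = blockIndex I} :=
    card_pos.2 ⟨1, by simp⟩
  rw [binomDelta, ← card_stabilizer_blockIndex, ← card_image_mul_card_stabilizer I,
    Nat.mul_div_cancel _ hpos]
end
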